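/- Let A be a finitely graded associative algebra over a field of characteristic ≠ 2, i.e., A = A_1 ⊕ A_2 ⊕ ⋯ with A_p A_q ⊆ A_{p+q}, A generated by A_1, and dim_F A_1 < ∞. Fix i ≥ 1 and suppose there exists n ≥ 1 such that A^n ⊆ id_A(A^{[i+2]}) (every product of n elements of A lies in the associative ideal generated by A^{[i+2]}). Then the Lie algebra A^{[i]} is generated, as a Lie algebra, by the finite-dimensional subspace A^{[i]} ∩ (A_1 ⊕ A_2 ⊕ ⋯ ⊕ A_{2n-2}). -/

import Mathlib

/-- The linear span of all commutators `u * v - v * u` with `u ∈ U`, `v ∈ V`. -/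
def commSpan (F : Type*) [Field F] {A : Type*} [NonUnitalRing A] [Module F A]
    [SMulCommClass F A A] [IsScalarTower F A A] (U V : Submodule F A) : Submodule F A :=
  Submodule.span F {x | ∃ u ∈ U, ∃ v ∈ V, x = u * v - v * u}

/-- The linear span of all products `u * v` with `u ∈ U`, `v ∈ V`. -/
def mulSpan (F : Type*) [Field F] {A : Type*} [NonUnitalRing A] [Module F A]
    [SMulCommClass F A A] [IsScalarTower F A A] (U V : Submodule F A) : Submodule F A :=
  Submodule.span F {x | ∃ u ∈ U, ∃ v ∈ V, x = u * v}

/-- `subPow F V n` is the span `V^{n+1}` of all products of `n + 1` elements of `V`. -/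
def subPow (F : Type*) [Field F] {A : Type*} [NonUnitalRing A] [Module F A]
    [SMulCommClass F A A] [IsScalarTower F A A] (V : Submodule F A) : ℕ → Submodule F A
  | 0 => V
  | n + 1 => mulSpan F V (subPow F V n)

/-- The Lie derived powers `A^{[0]} = A`, `A^{[i+1]} = [A^{[i]}, A^{[i]}]`. -/
def derivedPower (F : Type*) [Field F] (A : Type*) [NonUnitalRing A] [Module F A]
    [SMulCommClass F A A] [IsScalarTower F A A] : ℕ → Submodule F A
  | 0 => ⊤
  | i + 1 => commSpan F (derivedPower F A i) (derivedPower F A i)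

/-- The associative (non-unital) subalgebra generated by `S`. -/
def algClosure (F : Type*) [Field F] {A : Type*} [NonUnitalRing A] [Module F A]
    [SMulCommClass F A A] [IsScalarTower F A A] (S : Set A) : Submodule F A :=
  sInf {p : Submodule F A | S ⊆ ↑p ∧ ∀ x ∈ p, ∀ y ∈ p, x * y ∈ p}

/-- The Lie subalgebra of `A⁽⁻⁾` generated by `S`. -/
def lieClosure (F : Type*) [Field F] {A : Type*} [NonUnitalRing A] [Module F A]
    [SMulCommClass F A A] [IsScalarTower F A A] (S : Set A) : Submodule F A :=
  sInf {p : Submodule F A | S ⊆ ↑p ∧ ∀ x ∈ p, ∀ y ∈ p, x * y - y * x ∈ p}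

/-- The two-sided associative ideal of `A` generated by a set `S`. -/
def algIdealGen (F : Type*) [Field F] {A : Type*} [NonUnitalRing A] [Module F A]
    [SMulCommClass F A A] [IsScalarTower F A A] (S : Set A) : Submodule F A :=
  sInf {p : Submodule F A | S ⊆ ↑p ∧ ∀ a : A, ∀ x ∈ p, a * x ∈ p ∧ x * a ∈ p}

theorem mem_of_mem_iSup_of_iSupIndep {R M ι : Type*} [Ring R] [AddCommGroup M] [Module R M]
    {𝒜 V : ι → Submodule R M} (h : iSupIndep 𝒜) (hV : ∀ d, V d ≤ 𝒜 d) {d : ι} {x : M}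
    (hx : x ∈ 𝒜 d) (hx' : x ∈ ⨆ e, V e) : x ∈ V d := by
  have hle : ⨆ e, V e ≤ V d ⊔ ⨆ (e) (_ : e ≠ d), V e := by
    refine iSup_le fun e => ?_
    by_cases he : e = d
    · exact he ▸ le_sup_left
    · exact le_sup_of_le_right (le_iSup₂_of_le e he le_rfl)
  obtain ⟨v, hv, w, hw, rfl⟩ := Submodule.mem_sup.1 (hle hx')
  have hw0 : w = 0 := by
    refine Submodule.disjoint_def.1 (h d) w ?_ (iSup₂_mono (fun e _ => hV e) hw)
    simpa using sub_mem hx (hV d hv)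
  simpa [hw0] using hv

section DerivedPowers

variable {F : Type*} [Field F] {A : Type*} [NonUnitalRing A] [Module F A]

/-- The span of the commutators of total degree `d` of homogeneous elements of `U`. -/
def commDegree (𝒜 : ℕ → Submodule F A) (U : Submodule F A) (d : ℕ) : Submodule F A :=
  Submodule.span F
    {x | ∃ p q, p + q = d ∧ ∃ u ∈ U ⊓ 𝒜 p, ∃ v ∈ U ⊓ 𝒜 q, x = u * v - v * u}

theorem commDegree_le {𝒜 : ℕ → Submodule F A} {U W : Submodule F A} {d : ℕ}
    (h : ∀ p q, p + q = d → ∀ u ∈ U ⊓ 𝒜 p, ∀ v ∈ U ⊓ 𝒜 q, u * v - v * u ∈ W) :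
    commDegree 𝒜 U d ≤ W := by
  refine Submodule.span_le.2 ?_
  rintro _ ⟨p, q, hpq, u, hu, v, hv, rfl⟩
  exact h p q hpq u hu v hv

theorem commDegree_le_grading {𝒜 : ℕ → Submodule F A}
    (hmul : ∀ p q : ℕ, ∀ x ∈ 𝒜 p, ∀ y ∈ 𝒜 q, x * y ∈ 𝒜 (p + q)) (U : Submodule F A) (d : ℕ) :
    commDegree 𝒜 U d ≤ 𝒜 d := by
  refine commDegree_le ?_
  rintro p q rfl u hu v hv
  exact sub_mem (hmul p q u hu.2 v hv.2) (add_comm q p ▸ hmul q p v hv.2 u hu.2)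

variable [SMulCommClass F A A] [IsScalarTower F A A]

theorem commutator_mem_commSpan {U V : Submodule F A} {u v : A} (hu : u ∈ U) (hv : v ∈ V) :
    u * v - v * u ∈ commSpan F U V :=
  Submodule.subset_span ⟨u, hu, v, hv, rfl⟩

theorem commSpan_le {U V W : Submodule F A} :
    commSpan F U V ≤ W ↔ ∀ u ∈ U, ∀ v ∈ V, u * v - v * u ∈ W := by
  refine Submodule.span_le.trans ⟨fun h u hu v hv => h ⟨u, hu, v, hv, rfl⟩, ?_⟩
  rintro h _ ⟨u, hu, v, hv, rfl⟩
  exact h u hu v hv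

theorem mul_mem_mulSpan {U V : Submodule F A} {u v : A} (hu : u ∈ U) (hv : v ∈ V) :
    u * v ∈ mulSpan F U V :=
  Submodule.subset_span ⟨u, hu, v, hv, rfl⟩

theorem mulSpan_le {U V W : Submodule F A} :
    mulSpan F U V ≤ W ↔ ∀ u ∈ U, ∀ v ∈ V, u * v ∈ W := by
  refine Submodule.span_le.trans ⟨fun h u hu v hv => h ⟨u, hu, v, hv, rfl⟩, ?_⟩
  rintro h _ ⟨u, hu, v, hv, rfl⟩
  exact h u hu v hv

theorem mulSpan_mono {U U' V V' : Submodule F A} (hU : U ≤ U') (hV : V ≤ V') :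
    mulSpan F U V ≤ mulSpan F U' V' :=
  mulSpan_le.2 fun _ hu _ hv => mul_mem_mulSpan (hU hu) (hV hv)

theorem subPow_mono {U V : Submodule F A} (h : U ≤ V) (k : ℕ) : subPow F U k ≤ subPow F V k := by
  induction k with
  | zero => exact h
  | succ k ih => exact mulSpan_mono h ih

theorem subPow_top_antitone : Antitone (subPow F (⊤ : Submodule F A)) := by
  refine antitone_nat_of_succ_le fun k => ?_
  induction k with
  | zero => exact le_top
  | succ k ih => exact mulSpan_mono le_rfl ih

/-- A submodule `U` is a Lie ideal of `A⁽⁻⁾`. -/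
def IsLieIdeal (U : Submodule F A) : Prop :=
  ∀ u ∈ U, ∀ a : A, u * a - a * u ∈ U

theorem IsLieIdeal.commSpan_self {U : Submodule F A} (hU : IsLieIdeal U) :
    IsLieIdeal (commSpan F U U) := by
  intro x hx a
  have key : commSpan F U U ≤ (commSpan F U U).comap
      (LinearMap.mulRight F a - LinearMap.mulLeft F a) := by
    refine commSpan_le.2 fun u hu v hv => ?_
    have h := add_mem (commutator_mem_commSpan (hU u hu a) hv)
      (commutator_mem_commSpan hu (hU v hv a))
    rw [Submodule.mem_comap]
    convert h using 1
    simp only [LinearMap.sub_apply, LinearMap.mulRight_apply, LinearMap.mulLeft_apply]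
    noncomm_ring
  simpa using key hx

theorem isLieIdeal_derivedPower (k : ℕ) : IsLieIdeal (derivedPower F A k) := by
  induction k with
  | zero => exact fun _ _ _ => Submodule.mem_top
  | succ k ih => exact ih.commSpan_self

/-- Elements of `A` whose commutators with all of `A` lie in `U`. -/
def commTransporter (U : Submodule F A) : Submodule F A :=
  ⨅ a : A, U.comap (LinearMap.mulRight F a - LinearMap.mulLeft F a)

theorem mem_commTransporter {U : Submodule F A} {x : A} :
    x ∈ commTransporter U ↔ ∀ a : A, x * a - a * x ∈ U := by
  simp [commTransporter]

theorem mul_mem_commTransporter {U : Submodule F A} {x y : A} (hx : x ∈ commTransporter U)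
    (hy : y ∈ commTransporter U) : x * y ∈ commTransporter U := by
  rw [mem_commTransporter] at *
  intro a
  convert add_mem (hx (y * a)) (hy (a * x)) using 1
  noncomm_ring

/-- Herstein: the associative ideal generated by `[U, U]` has all its commutators
with `A` in `U`, for every Lie ideal `U`. -/
theorem IsLieIdeal.algIdealGen_commSpan_le {U : Submodule F A} (hU : IsLieIdeal U) :
    algIdealGen F (commSpan F U U : Set A) ≤ commTransporter U := by
  have hUT : U ≤ commTransporter U := fun u hu => mem_commTransporter.2 (hU u hu)
  set R : Submodule F A := commTransporter U ⊓
    ⨅ a : A, (commTransporter U).comap (LinearMap.mulRight F a)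
  have memR {x : A} : x ∈ R ↔ x ∈ commTransporter U ∧ ∀ a : A, x * a ∈ commTransporter U := by
    simp [R]
  refine le_trans (sInf_le (a := R) ⟨?_, ?_⟩) inf_le_left
  · refine commSpan_le.2 fun u hu v hv => memR.2 ⟨hUT (hU u hu v), fun a => ?_⟩
    have h : u * (v * a) - (v * a) * u - v * (u * a - a * u) ∈ commTransporter U :=
      sub_mem (hUT (hU u hu _)) (mul_mem_commTransporter (hUT hv) (hUT (hU u hu a)))
    convert h using 1
    noncomm_ring
  · intro a x hx
    obtain ⟨hx, hxa⟩ := memR.1 hx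
    have left_mul {y : A} (hy : y ∈ commTransporter U) (hya : y * a ∈ commTransporter U) :
        a * y ∈ commTransporter U := by
      simpa using sub_mem hya (hUT (mem_commTransporter.1 hy a))
    refine ⟨memR.2 ⟨left_mul hx (hxa a), fun b => ?_⟩, memR.2 ⟨hxa a, fun b => ?_⟩⟩
    · rw [mul_assoc]
      refine left_mul (hxa b) ?_
      rw [mul_assoc]
      exact hxa _
    · rw [mul_assoc]
      exact hxa _

theorem commDegree_le_commSpan (𝒜 : ℕ → Submodule F A) (U : Submodule F A) (d : ℕ) :
    commDegree 𝒜 U d ≤ commSpan F U U :=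
  commDegree_le fun _ _ _ _ hu _ hv => commutator_mem_commSpan hu.1 hv.1

theorem commSpan_le_iSup_commDegree {𝒜 : ℕ → Submodule F A} {U : Submodule F A}
    (hU : U ≤ ⨆ p, U ⊓ 𝒜 p) : commSpan F U U ≤ ⨆ d, commDegree 𝒜 U d := by
  refine commSpan_le.2 fun u hu v hv => ?_
  have hright {p : ℕ} {u : A} (hu : u ∈ U ⊓ 𝒜 p) : U ≤ (⨆ d, commDegree 𝒜 U d).comap
      (LinearMap.mulLeft F u - LinearMap.mulRight F u) :=
    hU.trans <| iSup_le fun q v hv => Submodule.mem_iSup_of_mem (p + q) <|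
      Submodule.subset_span ⟨p, q, rfl, u, hu, v, hv, by simp⟩
  have hleft : U ≤ (⨆ d, commDegree 𝒜 U d).comap
      (LinearMap.mulRight F v - LinearMap.mulLeft F v) :=
    hU.trans <| iSup_le fun p w hw => by simpa using hright hw hv
  simpa using hleft hu

theorem derivedPower_le_iSup_inf {𝒜 : ℕ → Submodule F A}
    (hmul : ∀ p q : ℕ, ∀ x ∈ 𝒜 p, ∀ y ∈ 𝒜 q, x * y ∈ 𝒜 (p + q)) (htop : ⨆ p, 𝒜 p = ⊤) (k : ℕ) :
    derivedPower F A k ≤ ⨆ p, derivedPower F A k ⊓ 𝒜 p := by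
  induction k with
  | zero => simp [derivedPower, htop]
  | succ k ih =>
    exact (commSpan_le_iSup_commDegree ih).trans <| iSup_mono fun d =>
      le_inf (commDegree_le_commSpan 𝒜 _ d) (commDegree_le_grading hmul _ d)

theorem derivedPower_succ_inf_le_commDegree {𝒜 : ℕ → Submodule F A}
    (hmul : ∀ p q : ℕ, ∀ x ∈ 𝒜 p, ∀ y ∈ 𝒜 q, x * y ∈ 𝒜 (p + q))
    (hdirect : DirectSum.IsInternal 𝒜) (k d : ℕ) :
    derivedPower F A (k + 1) ⊓ 𝒜 d ≤ commDegree 𝒜 (derivedPower F A k) d := fun _ hx =>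
  mem_of_mem_iSup_of_iSupIndep hdirect.submodule_iSupIndep (commDegree_le_grading hmul _) hx.2 <|
    commSpan_le_iSup_commDegree
      (derivedPower_le_iSup_inf hmul hdirect.submodule_iSup_eq_top k) hx.1

theorem mul_mem_subPow (V : Submodule F A) (p q : ℕ) {y : A} (hy : y ∈ subPow F V q) {x : A}
    (hx : x ∈ subPow F V p) : x * y ∈ subPow F V (p + q + 1) := by
  induction p generalizing x with
  | zero => exact (zero_add q).symm ▸ mul_mem_mulSpan hx hy
  | succ p ih =>
    have key : subPow F V (p + 1) ≤
        (subPow F V (p + 1 + q + 1)).comap (LinearMap.mulRight F y) := by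
      refine mulSpan_le.2 fun v hv w hw => ?_
      rw [Submodule.mem_comap, LinearMap.mulRight_apply, mul_assoc, Nat.add_right_comm p 1 q]
      exact mul_mem_mulSpan hv (ih hw)
    exact key hx

theorem algClosure_le_iSup_subPow (V : Submodule F A) :
    algClosure F (V : Set A) ≤ ⨆ p, subPow F V p := by
  refine sInf_le ⟨le_iSup (subPow F V) 0, fun x hx y hy => ?_⟩
  have hright {p : ℕ} {x : A} (hx : x ∈ subPow F V p) : ⨆ q, subPow F V q ≤
      (⨆ q, subPow F V q).comap (LinearMap.mulLeft F x) :=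
    iSup_le fun q v hv => Submodule.mem_iSup_of_mem (p + q + 1) (mul_mem_subPow V p q hv hx)
  have hleft : ⨆ q, subPow F V q ≤ (⨆ q, subPow F V q).comap (LinearMap.mulRight F y) :=
    iSup_le fun p w hw => hright hw hy
  exact hleft hx

theorem grading_succ_le_subPow {𝒜 : ℕ → Submodule F A} (hdirect : DirectSum.IsInternal 𝒜)
    (hmul : ∀ p q : ℕ, ∀ x ∈ 𝒜 p, ∀ y ∈ 𝒜 q, x * y ∈ 𝒜 (p + q))
    (hgen : algClosure F (𝒜 1 : Set A) = ⊤) (p : ℕ) : 𝒜 (p + 1) ≤ subPow F (𝒜 1) p := by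
  intro x hx
  have hle (q : ℕ) : subPow F (𝒜 1) q ≤ 𝒜 (q + 1) := by
    induction q with
    | zero => exact le_rfl
    | succ q ih =>
      refine mulSpan_le.2 fun u hu v hv => ?_
      rw [add_comm (q + 1)]
      exact hmul 1 (q + 1) u hu v (ih hv)
  exact mem_of_mem_iSup_of_iSupIndep
    (hdirect.submodule_iSupIndep.comp (add_left_injective 1)) hle hx
    (algClosure_le_iSup_subPow (𝒜 1) (hgen ▸ Submodule.mem_top))

theorem subset_lieClosure (S : Set A) : S ⊆ lieClosure F S := by
  intro x hx
  simp only [lieClosure, SetLike.mem_coe, Submodule.mem_sInf]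
  exact fun p hp => hp.1 hx

theorem commutator_mem_lieClosure {S : Set A} {x y : A} (hx : x ∈ lieClosure F S)
    (hy : y ∈ lieClosure F S) : x * y - y * x ∈ lieClosure F S := by
  simp only [lieClosure, Submodule.mem_sInf] at *
  exact fun p hp => hp.2 x (hx p hp) y (hy p hp)

end DerivedPowers

/-- Let `A` be a finitely graded associative algebra over a field of
characteristic `≠ 2`.  Fix `i ≥ 1` and suppose `n ≥ 1` satisfies `Aⁿ ⊆ id_A(A^{[i+2]})`
(note `Aⁿ = subPow F ⊤ (n-1)`).  Then the Lie algebra `A^{[i]}` is generated, as a Lie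
algebra, by the finite-dimensional subspace `A^{[i]} ∩ (A₁ ⊕ ⋯ ⊕ A_{2n-2})`. -/
theorem derivedPower_generated_by_low_degrees
    (F : Type*) [Field F] (hchar : ringChar F ≠ 2)
    (A : Type*) [NonUnitalRing A] [Module F A] [SMulCommClass F A A] [IsScalarTower F A A]
    (𝒜 : ℕ → Submodule F A) (h0 : 𝒜 0 = ⊥)
    (hdirect : DirectSum.IsInternal 𝒜)
    (hmul : ∀ p q : ℕ, ∀ x ∈ 𝒜 p, ∀ y ∈ 𝒜 q, x * y ∈ 𝒜 (p + q))
    (hgen : algClosure F (𝒜 1 : Set A) = ⊤)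
    (hfin : FiniteDimensional F (𝒜 1))
    (i : ℕ) (hi : 1 ≤ i)
    (n : ℕ) (hn : 1 ≤ n)
    (hpow : subPow F (⊤ : Submodule F A) (n - 1) ≤
      algIdealGen F (derivedPower F A (i + 2) : Set A)) :
    lieClosure F
        ((derivedPower F A i ⊓ ⨆ k ∈ Finset.Icc 1 (2 * n - 2), 𝒜 k : Submodule F A) : Set A) =
      derivedPower F A i := by
  have hhigh (p : ℕ) (hp : n ≤ p) (x : A) (hx : x ∈ 𝒜 p) (a : A) :
      x * a - a * x ∈ derivedPower F A (i + 1) := by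
    obtain ⟨p, rfl⟩ : ∃ q, p = q + 1 := ⟨p - 1, by omega⟩
    have hx' := hpow <| subPow_top_antitone (by omega : n - 1 ≤ p) <|
      subPow_mono le_top p <| grading_succ_le_subPow hdirect hmul hgen p hx
    exact mem_commTransporter.1
      ((isLieIdeal_derivedPower (i + 1)).algIdealGen_commSpan_le hx') a
  have hstep (d : ℕ) (hd : 2 * n - 2 < d) :
      derivedPower F A i ⊓ 𝒜 d ≤ derivedPower F A (i + 1) := by
    obtain ⟨j, rfl⟩ : ∃ j, i = j + 1 := ⟨i - 1, by omega⟩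
    refine (derivedPower_succ_inf_le_commDegree hmul hdirect j d).trans <|
      commDegree_le fun p q hpq u hu v hv => ?_
    rcases le_or_gt n p with hp | hp
    · exact hhigh p hp u hu.2 v
    · rw [← neg_sub]
      exact neg_mem (hhigh q (by omega) v hv.2 u)
  refine le_antisymm (sInf_le ⟨fun x hx => hx.1, fun x hx y hy =>
    isLieIdeal_derivedPower i x hx y⟩) ?_
  refine (derivedPower_le_iSup_inf hmul hdirect.submodule_iSup_eq_top i).trans <|
    iSup_le fun d => ?_
  induction d using Nat.strong_induction_on with
  | _ d ih =>
    rcases Nat.eq_zero_or_pos d with rfl | hd0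
    · simp [h0]
    rcases le_or_gt d (2 * n - 2) with hd | hd
    · exact fun x hx => subset_lieClosure _
        ⟨hx.1, (le_iSup₂ (f := fun k (_ : k ∈ Finset.Icc 1 (2 * n - 2)) => 𝒜 k) d
          (Finset.mem_Icc.2 ⟨hd0, hd⟩)) hx.2⟩
    · refine (le_inf (hstep d hd) inf_le_right).trans <|
        (derivedPower_succ_inf_le_commDegree hmul hdirect i d).trans <|
        commDegree_le fun p q hpq u hu v hv => ?_
      rcases Nat.eq_zero_or_pos p with rfl | hp
      · have hu0 : u = 0 := by simpa [h0] using hu.2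
        simp [hu0]
      rcases Nat.eq_zero_or_pos q with rfl | hq
      · have hv0 : v = 0 := by simpa [h0] using hv.2
        simp [hv0]
      exact commutator_mem_lieClosure (ih p (by omega) hu) (ih q (by omega) hv)
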